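/- Let O' be an integral domain, π, ϖ ∈ O' nonzero elements with ϖ dividing π, say π = ϖ·ρ with ρ ∈ O', and let q ≥ 2, r ≥ 1 be integers. Let (F_n)_{n ≥ 0}, (u_n)_{n ≥ 0}, (μ_n)_{n ≥ 0} be sequences of polynomials in O'[X_0, X_1, X_2, …] satisfying, for all m ≥ 0: Φ^{(π,q)}_m(F_0, …, F_m) = Φ^{(π,q)}_{m+1}(X_0, …, X_{m+1}); Φ^{(ϖ,q^r)}_m(u_0, …, u_m) = Φ^{(π,q)}_{rm}(X_0, …, X_{rm}); and Φ^{(ϖ,q^r)}_m(μ_0, …, μ_m) = ρ · Φ^{(ϖ,q^r)}_m(X_0, …, X_m). Then for every n ≥ 0, the polynomial obtained from u_n by the substitution X_0 ↦ 0, X_i ↦ X_{i−1} (i ≥ 1) equals the polynomial obtained from μ_n by the substitution X_0 ↦ 0, X_i ↦ (u ∘ F^{∘(r−1)})_{i−1} (i ≥ 1). -/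

import Mathlib

open MvPolynomial

/-- The `n`-th ramified Witt polynomial with respect to `(π, q)`,
evaluated at a sequence `b`: `Φ^{(π,q)}_n(b) = ∑_{i=0}^{n} π^i b_i^{q^{n-i}}`. -/
def wittPhi {R : Type*} [CommRing R] (π : R) (q : ℕ) (n : ℕ) (b : ℕ → R) : R :=
  ∑ i ∈ Finset.range (n + 1), π ^ i * b i ^ q ^ (n - i)

/-- Composite of two families of polynomials: `(g ∘ h)_n` is obtained by
substituting `h i` for `X i` in `g n`. -/
noncomputable def famComp {R : Type*} [CommRing R] (g h : ℕ → MvPolynomial ℕ R) :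
    ℕ → MvPolynomial ℕ R :=
  fun n => MvPolynomial.aeval h (g n)

/-- The `r`-fold composite `g^{∘r}` of a family of polynomials with itself;
`g^{∘0}` is the identity family `(X_n)_n`. -/
noncomputable def famIter {R : Type*} [CommRing R] (g : ℕ → MvPolynomial ℕ R) :
    ℕ → ℕ → MvPolynomial ℕ R
  | 0 => fun n => MvPolynomial.X n
  | r + 1 => famComp g (famIter g r)

theorem map_wittPhi {R S T : Type*} [CommRing R] [CommRing S] [FunLike T R S]
    [RingHomClass T R S] (f : T) (π : R) (q n : ℕ) (b : ℕ → R) :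
    f (wittPhi π q n b) = wittPhi (f π) q n (fun i => f (b i)) := by
  simp [wittPhi, map_sum]

/-- Over a domain with `π ≠ 0`, a sequence is determined by its ghost components. -/
theorem eq_of_wittPhi_eq {R : Type*} [CommRing R] [IsDomain R] {π : R} (hπ : π ≠ 0) (q : ℕ)
    {a b : ℕ → R} (h : ∀ m, wittPhi π q m a = wittPhi π q m b) (n : ℕ) : a n = b n := by
  induction n using Nat.strong_induction_on with
  | _ n ih =>
    have hn := h n
    simp only [wittPhi, Finset.sum_range_succ, Nat.sub_self, pow_zero, pow_one] at hn
    rw [Finset.sum_congr rfl fun i hi => by rw [ih i (Finset.mem_range.mp hi)]] at hn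
    exact mul_left_cancel₀ (pow_ne_zero n hπ) (add_left_cancel hn)

theorem wittPhi_zero_of_eq_zero {R : Type*} [CommRing R] (π : R) (q : ℕ) {b : ℕ → R}
    (hb : b 0 = 0) : wittPhi π q 0 b = 0 := by
  simp [wittPhi, hb]

/-- Ghost components of a shifted sequence. -/
theorem wittPhi_succ_of_eq_zero {R : Type*} [CommRing R] (π : R) {q : ℕ} (hq : q ≠ 0) (n : ℕ)
    {b : ℕ → R} (hb : b 0 = 0) :
    wittPhi π q (n + 1) b = π * wittPhi π q n (fun i => b (i + 1)) := by
  rw [wittPhi, Finset.sum_range_succ', hb, zero_pow (pow_ne_zero _ hq), mul_zero, add_zero,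
    wittPhi, Finset.mul_sum]
  refine Finset.sum_congr rfl fun i _ => ?_
  rw [Nat.add_sub_add_right, pow_succ']
  ring

/-- If `F` shifts ghost components by one, then `F^{∘k}` shifts them by `k`. -/
theorem wittPhi_famIter {R : Type*} [CommRing R] (π : R) (q : ℕ) (F : ℕ → MvPolynomial ℕ R)
    (hF : ∀ m : ℕ, wittPhi (C π) q m F = wittPhi (C π) q (m + 1) (fun i => X i)) (k m : ℕ) :
    wittPhi (C π) q m (famIter F k) = wittPhi (C π) q (m + k) (fun i => X i) := by
  induction k generalizing m with
  | zero => rfl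
  | succ k ih =>
    have h := congrArg (aeval (famIter F k)) (hF m)
    simp only [map_wittPhi, algHom_C, algebraMap_eq, aeval_X] at h
    rw [show m + (k + 1) = m + 1 + k by ring, ← ih (m + 1)]
    exact h

theorem stmt_11 {O' : Type*} [CommRing O'] [IsDomain O'] (π ϖ ρ : O')
    (hπ : π ≠ 0) (hϖ : ϖ ≠ 0) (hρ : π = ϖ * ρ)
    (q r : ℕ) (hq : 2 ≤ q) (hr : 1 ≤ r)
    (F u μ : ℕ → MvPolynomial ℕ O')
    (hF : ∀ m : ℕ, wittPhi (MvPolynomial.C π) q m F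
        = wittPhi (MvPolynomial.C π) q (m + 1) (fun i => MvPolynomial.X i))
    (hu : ∀ m : ℕ, wittPhi (MvPolynomial.C ϖ) (q ^ r) m u
        = wittPhi (MvPolynomial.C π) q (r * m) (fun i => MvPolynomial.X i))
    (hμ : ∀ m : ℕ, wittPhi (MvPolynomial.C ϖ) (q ^ r) m μ
        = MvPolynomial.C ρ * wittPhi (MvPolynomial.C ϖ) (q ^ r) m (fun i => MvPolynomial.X i)) :
    ∀ n : ℕ,
      MvPolynomial.aeval
          (fun i : ℕ => match i with
            | 0 => (0 : MvPolynomial ℕ O')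
            | k + 1 => MvPolynomial.X k) (u n)
        = MvPolynomial.aeval
            (fun i : ℕ => match i with
              | 0 => (0 : MvPolynomial ℕ O')
              | k + 1 => famComp u (famIter F (r - 1)) k) (μ n) := by
  have hqr : q ^ r ≠ 0 := pow_ne_zero _ (by lia)
  have hCϖ : (C ϖ : MvPolynomial ℕ O') ≠ 0 := by simpa using hϖ
  refine eq_of_wittPhi_eq hCϖ (q ^ r) fun m => ?_
  set s : ℕ → MvPolynomial ℕ O' := fun i => match i with
    | 0 => 0
    | k + 1 => X k
  set t : ℕ → MvPolynomial ℕ O' := fun i => match i with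
    | 0 => 0
    | k + 1 => famComp u (famIter F (r - 1)) k
  have hl := congrArg (aeval s) (hu m)
  have hm := congrArg (aeval t) (hμ m)
  simp only [map_wittPhi, map_mul, algHom_C, algebraMap_eq, aeval_X] at hl hm
  rw [hl, hm]
  cases m with
  | zero =>
    rw [mul_zero, wittPhi_zero_of_eq_zero _ _ rfl, wittPhi_zero_of_eq_zero _ _ rfl, mul_zero]
  | succ m =>
    have hY := congrArg (aeval (famIter F (r - 1))) (hu m)
    simp only [map_wittPhi, algHom_C, algebraMap_eq, aeval_X] at hY
    rw [wittPhi_famIter π q F hF] at hY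
    rw [show r * (m + 1) = r * m + (r - 1) + 1 by rw [mul_add]; lia,
      wittPhi_succ_of_eq_zero _ (by lia) _ rfl, wittPhi_succ_of_eq_zero _ hqr _ rfl,
      ← mul_assoc, mul_comm (C ρ), ← C_mul, ← hρ]
    exact congrArg (C π * ·) hY.symm
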